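/- Let v be a bivalued cost function with values s < l on a finite set M of chores, and suppose M can be partitioned into n bundles each of cost at most μ. If μ ≥ (13/2)·s, then FFD(M, v, (15/13)·μ) allocates all chores into at most n bins. -/

import Mathlib

open Finset

variable {α : Type*} [DecidableEq α]

/-- The total cost of a bundle `S` of chores under the additive cost function `v`. -/
def bundleCost (v : α → ℚ) (S : Finset α) : ℚ := ∑ c ∈ S, v c

/-- `P` is a partition of `M` into `d` (possibly empty) bundles. -/
def IsPartitionInto (M : Finset α) (d : ℕ) (P : Fin d → Finset α) : Prop :=
  (∀ j, P j ⊆ M) ∧ (∀ j k, j ≠ k → Disjoint (P j) (P k)) ∧ ∀ c ∈ M, ∃ j, c ∈ P j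

/-- `μ` is the `d`-maximin share `MMS^d(v, M)`: the minimum, over all partitions of `M`
into `d` bundles, of the maximum bundle cost. -/
def IsMMS (v : α → ℚ) (M : Finset α) (d : ℕ) (μ : ℚ) : Prop :=
  (∃ P : Fin d → Finset α, IsPartitionInto M d P ∧ ∀ j, bundleCost v (P j) ≤ μ) ∧
    ∀ P : Fin d → Finset α, IsPartitionInto M d P → ∃ j, μ ≤ bundleCost v (P j)

/-- Insert chore `c` into the first bin of the list whose cost stays at most `τ`;
open a new bin if it fits in no existing bin (and fits in an empty bin). -/
def ffdInsert (v : α → ℚ) (τ : ℚ) (c : α) : List (Finset α) → List (Finset α)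
  | [] => if v c ≤ τ then [{c}] else []
  | B :: rest =>
      if bundleCost v B + v c ≤ τ then insert c B :: rest
      else B :: ffdInsert v τ c rest

/-- The list of bins produced by FFD with threshold `τ` on the list `L` of chores
(processed in the order of `L`). -/
def ffdBins (v : α → ℚ) (τ : ℚ) (L : List α) : List (Finset α) :=
  L.foldl (fun bins c => ffdInsert v τ c bins) []

/-- `L` is a valid FFD processing order for `(M, v)`: an enumeration of `M`
in non-increasing order of cost. -/
def IsFFDList (v : α → ℚ) (M : Finset α) (L : List α) : Prop :=
  L.toFinset = M ∧ L.Nodup ∧ L.Pairwise fun c c' => v c' ≤ v c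

/-- FFD allocates all the chores into (at most) `n` bins. -/
def FFDAllocatesInto (v : α → ℚ) (τ : ℚ) (L : List α) (n : ℕ) : Prop :=
  (ffdBins v τ L).length ≤ n ∧ ∀ c ∈ L, ∃ B ∈ ffdBins v τ L, c ∈ B

/-- `v` is bivalued on `M` with values `s < l`. -/
def Bivalued (v : α → ℚ) (M : Finset α) (s l : ℚ) : Prop :=
  0 < s ∧ s < l ∧ ∀ c ∈ M, v c = s ∨ v c = l

theorem ffdInsert_length (v : α → ℚ) (τ : ℚ) (c : α) (bins : List (Finset α)) :
    (ffdInsert v τ c bins).length ≤ bins.length ∨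
      ((ffdInsert v τ c bins).length = bins.length + 1 ∧
        ∀ B ∈ bins, τ < bundleCost v B + v c) := by
  induction bins with
  | nil =>
    unfold ffdInsert
    split_ifs <;> simp
  | cons B rest ih =>
    unfold ffdInsert
    split_ifs with h
    · left; simp
    · push Not at h
      rcases ih with ih | ⟨ih, ih2⟩
      · left; simpa using ih
      · right
        refine ⟨by simpa using ih, ?_⟩
        intro B' hB'
        rcases List.mem_cons.1 hB' with rfl | hB'
        · exact h
        · exact ih2 _ hB'

theorem ffdInsert_sum (v : α → ℚ) (τ : ℚ) (c : α) (hc : v c ≤ τ) (bins : List (Finset α))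
    (hn : ∀ B ∈ bins, c ∉ B) :
    ((ffdInsert v τ c bins).map (bundleCost v)).sum = (bins.map (bundleCost v)).sum + v c := by
  induction bins with
  | nil =>
    simp [ffdInsert, hc, bundleCost]
  | cons B rest ih =>
    unfold ffdInsert
    have h1 : c ∉ B := hn B (by simp)
    split_ifs with h
    · simp only [List.map_cons, List.sum_cons, bundleCost, Finset.sum_insert h1]
      ring
    · simp only [List.map_cons, List.sum_cons]
      rw [ih (fun B' hB' => hn B' (by simp [hB']))]
      ring

theorem ffdInsert_subset (v : α → ℚ) (τ : ℚ) (c : α) (bins : List (Finset α)) (S : Finset α)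
    (hn : ∀ B ∈ bins, B ⊆ S) (hc : c ∈ S) :
    ∀ B ∈ ffdInsert v τ c bins, B ⊆ S := by
  induction bins with
  | nil =>
    unfold ffdInsert
    split_ifs <;> simp [hc]
  | cons B rest ih =>
    unfold ffdInsert
    have h1 := hn B (by simp)
    have h2 : ∀ B ∈ rest, B ⊆ S := fun B' hB' => hn B' (by simp [hB'])
    split_ifs with h
    · intro B' hB'
      rcases List.mem_cons.1 hB' with rfl | hB'
      · exact Finset.insert_subset hc h1
      · exact h2 _ hB'
    · intro B' hB'
      rcases List.mem_cons.1 hB' with rfl | hB'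
      · exact h1
      · exact ih h2 _ hB'

theorem ffdInsert_mem (v : α → ℚ) (τ : ℚ) (c : α) (hc : v c ≤ τ) (bins : List (Finset α)) :
    (∃ B ∈ ffdInsert v τ c bins, c ∈ B) ∧
    ∀ d, (∃ B ∈ bins, d ∈ B) → ∃ B ∈ ffdInsert v τ c bins, d ∈ B := by
  induction bins with
  | nil => simp [ffdInsert, hc]
  | cons B rest ih =>
    unfold ffdInsert
    split_ifs with h
    · refine ⟨by simp, ?_⟩
      rintro d ⟨B', hB', hd⟩
      rcases List.mem_cons.1 hB' with rfl | hB'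
      · exact ⟨_, List.mem_cons_self, by simp [hd]⟩
      · exact ⟨B', by simp [hB'], hd⟩
    · obtain ⟨⟨B1, hB1, hc1⟩, ih2⟩ := ih
      refine ⟨⟨B1, by simp [hB1], hc1⟩, ?_⟩
      rintro d ⟨B', hB', hd⟩
      rcases List.mem_cons.1 hB' with rfl | hB'
      · exact ⟨_, List.mem_cons_self, hd⟩
      · obtain ⟨B2, h2, h3⟩ := ih2 d ⟨B', hB', hd⟩
        exact ⟨B2, by simp [h2], h3⟩

theorem length_mul_le_sum (w : Finset α → ℚ) (x : ℚ) (bins : List (Finset α))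
    (h : ∀ B ∈ bins, x ≤ w B) : bins.length * x ≤ (bins.map w).sum := by
  have := List.card_nsmul_le_sum (bins.map w) x (by simpa using h)
  simpa using this

theorem sum_part_le (M : Finset α) (n : ℕ) (P : Fin n → Finset α) (hP : IsPartitionInto M n P)
    (w : α → ℚ) (hw : ∀ c ∈ M, 0 ≤ w c) : ∑ c ∈ M, w c ≤ ∑ j, ∑ c ∈ P j, w c := by
  obtain ⟨h1, h2, h3⟩ := hP
  have hM : M = Finset.univ.biUnion P := by
    ext c
    simp only [Finset.mem_biUnion, Finset.mem_univ, true_and]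
    exact ⟨h3 c, fun ⟨j, hj⟩ => h1 j hj⟩
  conv_lhs => rw [hM]
  rw [Finset.sum_biUnion]
  intro j _ k _ hjk
  exact h2 j k hjk

/-- for a bivalued cost function with `μ ≥ (13/2)·s`, if `M` can be
partitioned into `n` bundles each of cost at most `μ`, then FFD with threshold
`(15/13)·μ` allocates all chores into at most `n` bins. -/
theorem ffd_bivalued_large_mu
    (M : Finset α) (v : α → ℚ) (s l : ℚ) (hbv : Bivalued v M s l)
    (n : ℕ) (μ : ℚ)
    (hpart : ∃ P : Fin n → Finset α, IsPartitionInto M n P ∧ ∀ j, bundleCost v (P j) ≤ μ)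
    (hμ : 13 / 2 * s ≤ μ)
    (L : List α) (hL : IsFFDList v M L) :
    FFDAllocatesInto v (15 / 13 * μ) L n := by
  obtain ⟨P, hP, hcost⟩ := hpart
  obtain ⟨hs, hsl, hval⟩ := hbv
  obtain ⟨hLM, hnd, hsort⟩ := hL
  have hμ0 : 0 < μ := by linarith
  have hl : 0 < l := by linarith
  have hpos : ∀ c ∈ M, 0 < v c := by
    intro c hc
    rcases hval c hc with h | h <;> rw [h] <;> assumption
  have hmM : ∀ c, c ∈ L ↔ c ∈ M := by
    intro c; rw [← hLM]; simp
  -- every chore fits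
  have hfit : ∀ c ∈ M, v c ≤ μ := by
    intro c hc
    obtain ⟨j, hj⟩ := hP.2.2 c hc
    refine le_trans ?_ (hcost j)
    exact Finset.single_le_sum (f := v) (fun d hd => (hpos d (hP.1 j hd)).le) hj
  have htot : ∑ c ∈ M, v c ≤ n * μ := by
    refine (sum_part_le M n P hP v fun c hc => (hpos c hc).le).trans ?_
    refine (Finset.sum_le_sum fun j _ => hcost j).trans ?_
    simp
  obtain ⟨k, hk⟩ : ∃ k : ℕ, k = ⌊μ / l⌋₊ := ⟨_, rfl⟩
  have hkl : (k : ℚ) * l ≤ μ := by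
    have := Nat.floor_le (a := μ / l) (by positivity)
    rw [← hk] at this
    rwa [le_div_iff₀ hl] at this
  have hlarge : ∑ c ∈ M, (if v c = l then (1 : ℚ) else 0) ≤ n * k := by
    refine (sum_part_le M n P hP _ fun c hc => by split_ifs <;> norm_num).trans ?_
    have : ∀ j ∈ Finset.univ, ∑ c ∈ P j, (if v c = l then (1 : ℚ) else 0) ≤ k := by
      intro j _
      rw [Finset.sum_boole]
      have h1 : (((P j).filter fun c => v c = l).card : ℚ) ≤ μ / l := by
        rw [le_div_iff₀ hl]
        refine le_trans ?_ (hcost j)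
        calc _ = ∑ c ∈ (P j).filter (fun c => v c = l), v c := by
              rw [Finset.sum_congr rfl (g := fun _ => l)]
              · simp
              · intro c hc; exact (Finset.mem_filter.1 hc).2
          _ ≤ _ := Finset.sum_le_sum_of_subset_of_nonneg (Finset.filter_subset _ _)
              fun d hd _ => (hpos d (hP.1 j hd)).le
      have := Nat.le_floor h1
      rw [← hk] at this
      exact_mod_cast this
    refine (Finset.sum_le_sum this).trans ?_
    simp
  have key : ∀ p : List α, (∃ q, p ++ q = L) →
      (∀ B ∈ ffdBins v (15 / 13 * μ) p, B ⊆ p.toFinset) ∧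
      (∀ c ∈ p, ∃ B ∈ ffdBins v (15 / 13 * μ) p, c ∈ B) ∧
      ((ffdBins v (15 / 13 * μ) p).map (bundleCost v)).sum = (p.map v).sum ∧
      (ffdBins v (15 / 13 * μ) p).length ≤ n := by
    intro p
    induction p using List.reverseRecOn with
    | nil => intro _; simp [ffdBins]
    | append_singleton p c ih =>
      rintro ⟨q, hq⟩
      obtain ⟨ih1, ih2, ih3, ih4⟩ := ih ⟨[c] ++ q, by rw [← hq]; simp⟩
      have hstep : ffdBins v (15 / 13 * μ) (p ++ [c]) =
          ffdInsert v (15 / 13 * μ) c (ffdBins v (15 / 13 * μ) p) := by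
        simp [ffdBins]
      rw [hstep]
      generalize ffdBins v (15 / 13 * μ) p = bins at *
      have hpcL : ∀ d ∈ p ++ [c], d ∈ M := by
        intro d hd
        rw [← hmM, ← hq]
        exact List.mem_append_left _ hd
      have hcM : c ∈ M := hpcL c (by simp)
      have hndpc : (p ++ [c]).Nodup := by
        rw [← hq] at hnd
        exact hnd.of_append_left
      have hcp : c ∉ p := by
        intro h
        have := List.nodup_append.1 hndpc
        exact this.2.2 c h c (by simp) rfl
      have hsub : (p ++ [c]).toFinset ⊆ M := fun d hd => hpcL d (List.mem_toFinset.1 hd)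
      have hsumle : ∀ w : α → ℚ, (∀ d ∈ M, 0 ≤ w d) →
          (p.map w).sum + w c ≤ ∑ d ∈ M, w d := by
        intro w hw
        have h1 := Finset.sum_le_sum_of_subset_of_nonneg (f := w) hsub fun d hd _ => hw d hd
        rw [List.sum_toFinset w hndpc] at h1
        simpa using h1
      have hge : ∀ d ∈ p, v c ≤ v d := by
        intro d hd
        rw [← hq] at hsort
        have := (List.pairwise_append.1 (List.pairwise_append.1 hsort).1).2.2
        exact this d hd c (by simp)
      have hcfit : v c ≤ 15 / 13 * μ := by linarith [hfit c hcM]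
      refine ⟨?_, ?_, ?_, ?_⟩
      · apply ffdInsert_subset
        · intro B hB d hd
          have := ih1 B hB hd
          simp at this ⊢
          tauto
        · simp
      · have hm := ffdInsert_mem v (15 / 13 * μ) c hcfit bins
        intro d hd
        rcases List.mem_append.1 hd with hd | hd
        · exact hm.2 d (ih2 d hd)
        · rw [List.mem_singleton.1 hd]; exact hm.1
      · rw [ffdInsert_sum _ _ _ hcfit, ih3]
        · simp
        · intro B hB hc
          exact hcp (List.mem_toFinset.1 (ih1 B hB hc))
      · rcases ffdInsert_length v (15 / 13 * μ) c bins with h | ⟨h, hover⟩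
        · exact h.trans ih4
        · by_contra hcon
          have hlen : bins.length = n := by omega
          rcases hval c hcM with hvc | hvc
          · have h1 := length_mul_le_sum (bundleCost v) μ bins (by
              intro B hB
              have := hover B hB
              linarith)
            have h2 := hsumle v (fun d hd => (hpos d hd).le)
            rw [hlen, ih3] at h1
            linarith
          · have hpl : ∀ d ∈ p, v d = l := by
              intro d hd
              rcases hval d (hpcL d (by simp [hd])) with h | h
              · have := hge d hd
                linarith
              · exact h
            have h1 := length_mul_le_sum (bundleCost v) (k * l) bins (by
              intro B hB
              have h3 := hover B hB
              have h4 : bundleCost v B = B.card * l := by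
                unfold bundleCost
                rw [Finset.sum_congr rfl (g := fun _ => l)]
                · simp
                · intro d hd; exact hpl d (List.mem_toFinset.1 (ih1 B hB hd))
              rw [h4, hvc] at h3
              rw [h4]
              have h5 : (k : ℚ) * l < ((B.card + 1 : ℕ) : ℚ) * l := by
                push_cast
                linarith
              have h6 := lt_of_mul_lt_mul_right h5 hl.le
              have h7 : k ≤ B.card := by
                have : k < B.card + 1 := by exact_mod_cast h6
                omega
              have h8 : (k : ℚ) ≤ B.card := by exact_mod_cast h7
              exact mul_le_mul_of_nonneg_right h8 hl.le)
            have h2 := hsumle (fun d => if v d = l then (1 : ℚ) else 0)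
              (fun d hd => by split_ifs <;> norm_num)
            have h9 : p.map (fun d => if v d = l then (1 : ℚ) else 0) = p.map (fun _ => (1 : ℚ)) :=
              List.map_congr_left fun d hd => by simp [hpl d hd]
            have h10 : p.map v = p.map (fun _ => l) := List.map_congr_left hpl
            rw [hlen, ih3, h10] at h1
            rw [h9] at h2
            simp [hvc] at h1 h2
            have h11 : ((n : ℚ) * k) * l ≤ p.length * l := by linarith
            have h12 := le_of_mul_le_mul_right h11 hl
            simp at hlarge
            linarith
  obtain ⟨-, h2, -, h4⟩ := key L ⟨[], by simp⟩
  exact ⟨h4, h2⟩
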